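/- arXiv:2101.06154 — 2 statements merged into one kernel-verified Lean document; each statement's English description precedes it below -/
import Mathlib

section
/- Fix integers n₀, n₁, m ≥ 1, reals p, q with 1 ≤ p < ∞ and 0 < q ≤ ∞, and μ > 0, and let p* be the Hölder conjugate of p. Set N₁ = 4^{n₁} − 1 and N₀ = 4^{n₀} − 1. Let α̂ ∈ ℝ^{N₁}, let v̂₁, …, v̂_m ∈ ℝ^{N₀}, and let 𝒞 be any nonempty set of N₁×N₀ real matrices such that ‖M̂‖_{p,q} ≤ μ for every M̂ ∈ 𝒞. Define R = 2^{−m} ∑_{ε ∈ {−1,1}^m} (1/m) · sup_{M̂ ∈ 𝒞} |∑_{i=1}^m ε_i · (α̂ · (M̂ v̂_i))|. Then: (1) if 1 ≤ p ≤ 2, R ≤ μ · N₁^{max{1/p*, 1/q}} · (√(min{p*, 8n₀})/√m) · ‖α̂‖_p · max_i ‖v̂_i‖_{p*}; and (2) if 2 < p < ∞, R ≤ μ · N₁^{max{1/p*, 1/q}} · (√(p*)/m^{1/p}) · ‖α̂‖_p · max_i ‖v̂_i‖_{p*}. (This is the paper's Theorem 2 for unital quantum circuits and traceless observables: M̂ is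 the modified representation matrix of a unital channel, obtained by deleting the row and column indexed by the identity Pauli, α̂ the modified representation vector of the traceless observable H, and v̂_i that of the input state.) -/
open scoped ENNReal BigOperators
open Matrix

/-- The `l_p` norm of a finitely-indexed real vector, for `0 < p ≤ ∞`
(for `p = ∞` it is the max of the absolute values of the entries). -/
noncomputable def vecLpNorm {ι : Type*} [Fintype ι] (p : ℝ≥0∞) (w : ι → ℝ) : ℝ :=
  if p = ∞ then ⨆ j, |w j| else (∑ j, |w j| ^ p.toReal) ^ (1 / p.toReal)

/-- The `(p,q)` group norm of a real matrix:
`‖M‖_{p,q} = ((1/N₁) ∑_i ‖M_i‖_p^q)^{1/q}`, with `‖M‖_{p,∞} = max_i ‖M_i‖_p`. -/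
noncomputable def groupNorm {ι κ : Type*} [Fintype ι] [Fintype κ]
    (p q : ℝ≥0∞) (M : Matrix ι κ ℝ) : ℝ :=
  if q = ∞ then ⨆ i, vecLpNorm p (M i)
  else ((Fintype.card ι : ℝ)⁻¹ * ∑ i, vecLpNorm p (M i) ^ q.toReal) ^ (1 / q.toReal)

/-- The Hölder conjugate `p*` of a real `p ≥ 1`, as an extended nonnegative real
(so that `1* = ∞`). -/
noncomputable def hconj (p : ℝ) : ℝ≥0∞ :=
  if p = 1 then ∞ else ENNReal.ofReal (p / (p - 1))

/-- `min {p*, 8 n₀}`, interpreted as `8 n₀` when `p* = ∞` (i.e. when `p = 1`). -/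
noncomputable def minConj (p : ℝ) (n₀ : ℕ) : ℝ :=
  if p = 1 then 8 * n₀ else min (p / (p - 1)) (8 * n₀)

/-- The signed sum `∑ i, ε i * a i` attached to a choice of signs `ε`. -/
noncomputable def signSum {m : ℕ} (a : Fin m → ℝ) (ε : Fin m → Bool) : ℝ :=
  ∑ i, (if ε i then (1 : ℝ) else -1) * a i

lemma sum_range_two_mul_add_one (f : ℕ → ℝ) (k : ℕ) :
    ∑ i ∈ Finset.range (2 * k + 1), f i =
      ∑ j ∈ Finset.range (k + 1), f (2 * j) + ∑ j ∈ Finset.range k, f (2 * j + 1) := by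
  induction k with
  | zero => simp
  | succ k ih =>
    rw [show 2 * (k + 1) + 1 = 2 * k + 1 + 1 + 1 by ring, Finset.sum_range_succ,
      Finset.sum_range_succ, ih, Finset.sum_range_succ _ (k + 1), Finset.sum_range_succ _ k,
      Finset.sum_range_succ (fun j => f (2 * j + 1)) k, show 2 * (k + 1) = 2 * k + 1 + 1 by ring]
    ring

lemma add_pow_add_neg_add_pow (a x : ℝ) (k : ℕ) :
    (a + x) ^ (2 * k) + (-a + x) ^ (2 * k) =
      2 * ∑ j ∈ Finset.range (k + 1), (a ^ 2) ^ j * x ^ (2 * (k - j)) * (2 * k).choose (2 * j) := by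
  rw [add_pow, add_pow, sum_range_two_mul_add_one, sum_range_two_mul_add_one]
  have h1 : ∀ j, (-a) ^ (2 * j) = a ^ (2 * j) := fun j => (even_two_mul j).neg_pow a
  have h2 : ∀ j, (-a) ^ (2 * j + 1) = -a ^ (2 * j + 1) :=
    fun j => (odd_two_mul_add_one j).neg_pow a
  simp only [h1, h2, neg_mul, Finset.sum_neg_distrib, ← pow_mul, Nat.mul_sub]
  ring

/-- The Gaussian moment `(2k)! / (2 ^ k k!)`. -/
noncomputable def gaussMoment (k : ℕ) : ℝ := (2 * k).factorial / (2 ^ k * k.factorial)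

lemma gaussMoment_le (k : ℕ) : gaussMoment k ≤ (k : ℝ) ^ k := by
  unfold gaussMoment
  rw [div_le_iff₀ (by positivity)]
  have h := Nat.factorial_mul_descFactorial (show k ≤ 2 * k by omega)
  have h' := Nat.descFactorial_le_pow (2 * k) k
  rw [show 2 * k - k = k by omega] at h
  have : (2 * k).factorial ≤ k ^ k * (2 ^ k * k.factorial) := by
    rw [← h, ← mul_assoc, ← mul_pow, mul_comm k 2, mul_comm]
    gcongr
  exact_mod_cast this

lemma gaussMoment_mul_choose_le {j k : ℕ} (h : j ≤ k) :
    gaussMoment (k - j) * (2 * k).choose (2 * j) ≤ gaussMoment k * k.choose j := by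
  unfold gaussMoment
  rw [Nat.cast_choose ℝ h, Nat.cast_choose ℝ (show 2 * j ≤ 2 * k by omega), ← Nat.mul_sub]
  have hj : (2 : ℝ) ^ j * j.factorial ≤ (2 * j).factorial := by
    exact_mod_cast Nat.two_pow_mul_factorial_le_factorial_two_mul j
  have hk : (2 : ℝ) ^ k = 2 ^ j * 2 ^ (k - j) := by rw [← pow_add]; congr 1; omega
  have e1 : ((2 * (k - j)).factorial : ℝ) / (2 ^ (k - j) * (k - j).factorial) *
      ((2 * k).factorial / ((2 * j).factorial * (2 * (k - j)).factorial)) =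
      (2 * k).factorial / (2 ^ (k - j) * (k - j).factorial) / (2 * j).factorial := by
    have := Nat.factorial_ne_zero (2 * (k - j))
    field_simp
  have e2 : ((2 * k).factorial : ℝ) / (2 ^ k * k.factorial) *
      (k.factorial / (j.factorial * (k - j).factorial)) =
      (2 * k).factorial / (2 ^ (k - j) * (k - j).factorial) / (2 ^ j * j.factorial) := by
    rw [hk]
    field_simp
  rw [e1, e2]
  gcongr

lemma sum_signSum_succ {m : ℕ} (a : Fin (m + 1) → ℝ) (f : ℝ → ℝ) :
    ∑ ε, f (signSum a ε) =
      ∑ ε, (f (a 0 + signSum (fun i => a i.succ) ε) + f (-a 0 + signSum (fun i => a i.succ) ε)) := by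
  rw [← (Fin.consEquiv fun _ : Fin (m + 1) => Bool).sum_comp, Fintype.sum_prod_type,
    Finset.sum_comm]
  simp [signSum, Fin.sum_univ_succ, Fin.consEquiv]

lemma mean_signSum_pow_le_gaussMoment {m : ℕ} (a : Fin m → ℝ) (k : ℕ) :
    ((2 : ℝ) ^ m)⁻¹ * ∑ ε, signSum a ε ^ (2 * k) ≤ gaussMoment k * (∑ i, a i ^ 2) ^ k := by
  induction m generalizing k with
  | zero =>
    cases k with
    | zero => simp [gaussMoment]
    | succ k => simp [signSum]
  | succ m ih =>
    rw [sum_signSum_succ a (fun x => x ^ (2 * k)), Fin.sum_univ_succ]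
    set b : Fin m → ℝ := fun i => a i.succ with hb
    simp only [add_pow_add_neg_add_pow]
    rw [← Finset.mul_sum, Finset.sum_comm, add_pow, Finset.mul_sum, Finset.mul_sum, Finset.mul_sum]
    refine Finset.sum_le_sum fun j hj => ?_
    have hjk : j ≤ k := by simpa [Nat.lt_succ_iff] using hj
    have h1 := ih b (k - j)
    have h2 := gaussMoment_mul_choose_le hjk
    calc ((2 : ℝ) ^ (m + 1))⁻¹ * (2 * ∑ ε, (a 0 ^ 2) ^ j * signSum b ε ^ (2 * (k - j)) *
          (2 * k).choose (2 * j))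
        = (a 0 ^ 2) ^ j * (2 * k).choose (2 * j) *
          (((2 : ℝ) ^ m)⁻¹ * ∑ ε, signSum b ε ^ (2 * (k - j))) := by
          rw [← Finset.sum_mul, ← Finset.mul_sum, pow_succ, mul_inv]
          ring
      _ ≤ (a 0 ^ 2) ^ j * (2 * k).choose (2 * j) *
          (gaussMoment (k - j) * (∑ i, b i ^ 2) ^ (k - j)) := by gcongr
      _ = (gaussMoment (k - j) * (2 * k).choose (2 * j)) *
          ((a 0 ^ 2) ^ j * (∑ i, b i ^ 2) ^ (k - j)) := by ring
      _ ≤ (gaussMoment k * k.choose j) * ((a 0 ^ 2) ^ j * (∑ i, b i ^ 2) ^ (k - j)) := by gcongr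
      _ = _ := by ring

lemma mean_rpow_le {m : ℕ} {r : ℝ} (hr : 1 ≤ r) (f : (Fin m → Bool) → ℝ) (hf : ∀ ε, 0 ≤ f ε) :
    ((2 : ℝ) ^ m)⁻¹ * ∑ ε, f ε ≤ (((2 : ℝ) ^ m)⁻¹ * ∑ ε, f ε ^ r) ^ (1 / r) := by
  have := Real.arith_mean_le_rpow_mean Finset.univ (fun _ : Fin m → Bool => ((2 : ℝ) ^ m)⁻¹) f
    (fun _ _ => by positivity) (by simp) (fun ε _ => hf ε) hr
  simpa only [Finset.mul_sum] using this

/-- Comparison of a moment of a signed sum with an even moment. -/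
lemma mean_abs_signSum_rpow_le {m : ℕ} (a : Fin m → ℝ) {s : ℝ} {k : ℕ} (hs : 0 < s)
    (hk : s ≤ 2 * k) :
    ((2 : ℝ) ^ m)⁻¹ * ∑ ε, |signSum a ε| ^ s ≤ ((k : ℝ) * ∑ i, a i ^ 2) ^ (s / 2) := by
  have hk0 : (0 : ℝ) < k := by linarith
  have h := mean_rpow_le (r := 2 * k / s) (by rwa [le_div_iff₀ hs, one_mul])
    (fun ε => |signSum a ε| ^ s) (fun ε => by positivity)
  refine h.trans ?_
  have e : ∀ ε, (|signSum a ε| ^ s) ^ (2 * (k : ℝ) / s) = signSum a ε ^ (2 * k) := fun ε => by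
    rw [← Real.rpow_mul (abs_nonneg _), mul_div_cancel₀ _ hs.ne']
    rw [show (2 * (k : ℝ)) = ((2 * k : ℕ) : ℝ) by push_cast; ring, Real.rpow_natCast,
      (even_two_mul k).pow_abs]
  simp only [e]
  have h2 : ((2 : ℝ) ^ m)⁻¹ * ∑ ε, signSum a ε ^ (2 * k) ≤ ((k : ℝ) * ∑ i, a i ^ 2) ^ k := by
    refine (mean_signSum_pow_le_gaussMoment a k).trans ?_
    rw [mul_pow]
    gcongr
    exact gaussMoment_le k
  have h0 : 0 ≤ ((2 : ℝ) ^ m)⁻¹ * ∑ ε, signSum a ε ^ (2 * k) := by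
    have : ∀ ε, 0 ≤ signSum a ε ^ (2 * k) := fun ε => (even_two_mul k).pow_nonneg _
    exact mul_nonneg (by positivity) (Finset.sum_nonneg fun ε _ => this ε)
  refine (Real.rpow_le_rpow h0 h2 (by positivity)).trans_eq ?_
  rw [← Real.rpow_natCast, ← Real.rpow_mul (by positivity)]
  congr 1
  field_simp

lemma vecLpNorm_ofReal {ι : Type*} [Fintype ι] {s : ℝ} (hs : 0 ≤ s) (w : ι → ℝ) :
    vecLpNorm (ENNReal.ofReal s) w = (∑ j, |w j| ^ s) ^ (1 / s) := by
  simp [vecLpNorm, ENNReal.toReal_ofReal hs]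

lemma vecLpNorm_nonneg {ι : Type*} [Fintype ι] (s : ℝ≥0∞) (w : ι → ℝ) : 0 ≤ vecLpNorm s w := by
  unfold vecLpNorm
  split_ifs
  · exact Real.iSup_nonneg fun _ => abs_nonneg _
  · positivity

lemma abs_le_vecLpNorm {ι : Type*} [Fintype ι] {s : ℝ≥0∞} (hs : 0 < s) (w : ι → ℝ) (j : ι) :
    |w j| ≤ vecLpNorm s w := by
  unfold vecLpNorm
  split_ifs with h
  · exact le_ciSup (f := fun j => |w j|) (Set.finite_range _).bddAbove j
  · have h0 : 0 < s.toReal := ENNReal.toReal_pos hs.ne' h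
    rw [one_div, Real.le_rpow_inv_iff_of_pos (abs_nonneg _) (by positivity) h0]
    exact Finset.single_le_sum (f := fun j => |w j| ^ s.toReal) (fun _ _ => by positivity)
      (Finset.mem_univ j)

lemma vecLpNorm_rpow {ι : Type*} [Fintype ι] {s : ℝ} (hs : 0 < s) (w : ι → ℝ) :
    vecLpNorm (ENNReal.ofReal s) w ^ s = ∑ j, |w j| ^ s := by
  rw [vecLpNorm_ofReal hs.le, ← Real.rpow_mul (by positivity), one_div_mul_cancel hs.ne',
    Real.rpow_one]

lemma vecLpNorm_top_le {ι : Type*} [Fintype ι] {w : ι → ℝ} {B : ℝ} (hB : 0 ≤ B)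
    (h : ∀ j, |w j| ≤ B) : vecLpNorm ∞ w ≤ B := by
  simpa [vecLpNorm] using Real.iSup_le h hB

/-- `l_s` norms decrease in `s`. -/
lemma vecLpNorm_anti {ι : Type*} [Fintype ι] {r s : ℝ≥0∞} (hr : 0 < r) (hrs : r ≤ s)
    (w : ι → ℝ) : vecLpNorm s w ≤ vecLpNorm r w := by
  rcases eq_or_ne s ∞ with rfl | hs
  · exact vecLpNorm_top_le (vecLpNorm_nonneg _ _) (abs_le_vecLpNorm hr w)
  have hr' : r ≠ ∞ := ne_top_of_le_ne_top hs hrs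
  lift r to NNReal using hr'
  lift s to NNReal using hs
  have hr0 : (0 : ℝ) < r := by exact_mod_cast hr
  have hrs' : (r : ℝ) ≤ s := by exact_mod_cast hrs
  have hs0 : (0 : ℝ) < s := hr0.trans_le hrs'
  set A := vecLpNorm r w with hA
  have hA0 : 0 ≤ A := vecLpNorm_nonneg _ _
  have key : ∑ j, |w j| ^ (s : ℝ) ≤ A ^ (s : ℝ) := by
    have e : (s : ℝ) = (s - r) + r := by ring
    calc ∑ j, |w j| ^ (s : ℝ) ≤ ∑ j, A ^ ((s : ℝ) - r) * |w j| ^ (r : ℝ) := by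
          refine Finset.sum_le_sum fun j _ => ?_
          conv_lhs => rw [e, Real.rpow_add_of_nonneg (abs_nonneg _) (by linarith) hr0.le]
          have := abs_le_vecLpNorm hr w j
          have : |w j| ^ ((s : ℝ) - r) ≤ A ^ ((s : ℝ) - r) :=
            Real.rpow_le_rpow (abs_nonneg _) this (by linarith)
          gcongr
      _ = A ^ ((s : ℝ) - r) * A ^ (r : ℝ) := by
          have := vecLpNorm_rpow hr0 w
          rw [ENNReal.ofReal_coe_nnreal] at this
          rw [← Finset.mul_sum, ← this]
      _ = A ^ (s : ℝ) := by
          conv_rhs => rw [e, Real.rpow_add_of_nonneg hA0 (by linarith) hr0.le]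
  have := vecLpNorm_ofReal hs0.le w
  rw [ENNReal.ofReal_coe_nnreal] at this
  rw [this, one_div, Real.rpow_inv_le_iff_of_pos (by positivity) hA0 hs0]
  exact key

/-- The reverse comparison of `l_s` norms, with a dimensional constant. -/
lemma vecLpNorm_le_card_rpow_mul {ι : Type*} [Fintype ι] [Nonempty ι] {r s : ℝ≥0∞} (hr : 0 < r)
    (hrs : r ≤ s) (hr' : r ≠ ∞) (w : ι → ℝ) :
    vecLpNorm r w ≤ (Fintype.card ι : ℝ) ^ (r⁻¹.toReal - s⁻¹.toReal) * vecLpNorm s w := by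
  have hN : (0 : ℝ) < Fintype.card ι := by exact_mod_cast Fintype.card_pos
  lift r to NNReal using hr'
  have hr0 : (0 : ℝ) < r := by exact_mod_cast hr
  have er := vecLpNorm_ofReal hr0.le w
  rw [ENNReal.ofReal_coe_nnreal] at er
  rw [er, one_div, Real.rpow_inv_le_iff_of_pos (by positivity)
    (mul_nonneg (by positivity) (vecLpNorm_nonneg _ _)) hr0,
    Real.mul_rpow (by positivity) (vecLpNorm_nonneg _ _), ← Real.rpow_mul hN.le]
  rcases eq_or_ne s ∞ with rfl | hs
  · calc ∑ j, |w j| ^ (r : ℝ) ≤ ∑ _j : ι, vecLpNorm ∞ w ^ (r : ℝ) := by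
          refine Finset.sum_le_sum fun j _ => ?_
          have := abs_le_vecLpNorm (s := ∞) (by simp) w j
          gcongr
      _ = _ := by simp [hr0.ne']
  lift s to NNReal using hs
  have hrs' : (r : ℝ) ≤ s := by exact_mod_cast hrs
  have hs0 : (0 : ℝ) < s := hr0.trans_le hrs'
  have es := vecLpNorm_ofReal hs0.le w
  rw [ENNReal.ofReal_coe_nnreal] at es
  have h := Real.rpow_sum_le_const_mul_sum_rpow_of_nonneg (s := Finset.univ)
    (f := fun j => |w j| ^ (r : ℝ)) (p := (s : ℝ) / r) (by rwa [le_div_iff₀ hr0, one_mul])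
    (fun _ _ => by positivity)
  have e : ∀ j, (|w j| ^ (r : ℝ)) ^ ((s : ℝ) / r) = |w j| ^ (s : ℝ) := fun j => by
    rw [← Real.rpow_mul (abs_nonneg _), mul_div_cancel₀ _ hr0.ne']
  simp only [e, Finset.card_univ] at h
  rw [← Real.le_rpow_inv_iff_of_pos (by positivity) (by positivity) (by positivity),
    Real.mul_rpow (by positivity) (by positivity), ← Real.rpow_mul hN.le] at h
  refine h.trans_eq ?_
  rw [es, ← Real.rpow_mul (by positivity)]
  simp only [ENNReal.toReal_inv, ENNReal.coe_toReal]
  congr 2 <;> field_simp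

lemma one_le_hconj {p : ℝ} (hp : 1 ≤ p) : 1 ≤ hconj p := by
  unfold hconj
  split_ifs with h
  · simp
  · have : 1 < p := lt_of_le_of_ne hp (Ne.symm h)
    rw [ENNReal.one_le_ofReal, le_div_iff₀ (by linarith)]
    linarith

lemma toReal_inv_hconj {p : ℝ} (hp : 1 ≤ p) : (hconj p)⁻¹.toReal = 1 - 1 / p := by
  unfold hconj
  split_ifs with h
  · simp [h]
  · have : 1 < p := lt_of_le_of_ne hp (Ne.symm h)
    have : 0 < p - 1 := by linarith
    rw [ENNReal.toReal_inv, ENNReal.toReal_ofReal (by positivity)]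
    field_simp

lemma abs_dotProduct_le {ι : Type*} [Fintype ι] {p : ℝ} (hp : 1 ≤ p) (a b : ι → ℝ) :
    |a ⬝ᵥ b| ≤ vecLpNorm (ENNReal.ofReal p) a * vecLpNorm (hconj p) b := by
  have h1 : |a ⬝ᵥ b| ≤ ∑ j, |a j| * |b j| := by
    refine (Finset.abs_sum_le_sum_abs _ _).trans_eq ?_
    simp [abs_mul]
  refine h1.trans ?_
  rcases eq_or_lt_of_le hp with rfl | h
  · have : vecLpNorm (ENNReal.ofReal 1) a = ∑ j, |a j| := by
      rw [vecLpNorm_ofReal zero_le_one]; simp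
    rw [this, Finset.sum_mul]
    refine Finset.sum_le_sum fun j _ => ?_
    have := abs_le_vecLpNorm (s := hconj 1) (by simp [hconj]) b j
    gcongr
  · have hc : p.HolderConjugate (p / (p - 1)) := Real.HolderConjugate.conjExponent h
    have := Real.inner_le_Lp_mul_Lq Finset.univ (fun j => |a j|) (fun j => |b j|) hc
    simp only [abs_abs] at this
    rw [hconj, if_neg h.ne', vecLpNorm_ofReal (by linarith), vecLpNorm_ofReal hc.symm.nonneg]
    exact this

lemma groupNorm_eq {ι κ : Type*} [Fintype ι] [Fintype κ] (p q : ℝ≥0∞) (M : Matrix ι κ ℝ) :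
    groupNorm p q M =
      (Fintype.card ι : ℝ) ^ (-q⁻¹.toReal) * vecLpNorm q (fun i => vecLpNorm p (M i)) := by
  unfold groupNorm
  rw [vecLpNorm]
  simp only [abs_of_nonneg (vecLpNorm_nonneg _ _)]
  split_ifs with h
  · simp [h]
  · have : ∀ i, 0 ≤ vecLpNorm p (M i) := fun i => vecLpNorm_nonneg _ _
    have h0 : 0 ≤ ∑ i, vecLpNorm p (M i) ^ q.toReal :=
      Finset.sum_nonneg fun i _ => Real.rpow_nonneg (this i) _
    rw [Real.mul_rpow (by positivity) h0, Real.inv_rpow (by positivity),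
      Real.rpow_neg (by positivity), ENNReal.toReal_inv, one_div]

lemma vecLpNorm_rows_le_groupNorm {ι κ : Type*} [Fintype ι] [Fintype κ] [Nonempty ι]
    {s p q : ℝ≥0∞} (hs : 0 < s) (hq : 0 < q) (M : Matrix ι κ ℝ) :
    vecLpNorm s (fun i => vecLpNorm p (M i)) ≤
      (Fintype.card ι : ℝ) ^ max s⁻¹.toReal q⁻¹.toReal * groupNorm p q M := by
  have hN : (1 : ℝ) ≤ Fintype.card ι := by exact_mod_cast Fintype.card_pos
  have hN0 : (0 : ℝ) < Fintype.card ι := by linarith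
  rw [groupNorm_eq, ← mul_assoc, ← Real.rpow_add hN0]
  set x := fun i => vecLpNorm p (M i)
  have hx := vecLpNorm_nonneg q x
  rcases le_total q s with h | h
  · refine (vecLpNorm_anti hq h x).trans (le_mul_of_one_le_left hx ?_)
    refine Real.one_le_rpow hN ?_
    linarith [le_max_right s⁻¹.toReal q⁻¹.toReal]
  · rcases eq_or_ne s ∞ with rfl | hs'
    · obtain rfl : q = ∞ := top_le_iff.1 h
      simp
    refine (vecLpNorm_le_card_rpow_mul hs h hs' x).trans ?_
    gcongr
    linarith [le_max_left s⁻¹.toReal q⁻¹.toReal]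

/-- Khintchine's inequality for exponents at least two, with the quadratic mean replaced by the
`l_s` norm of the coefficients. -/
lemma mean_abs_signSum_rpow_le_of_two_le {m : ℕ} (hm : 1 ≤ m) {s : ℝ} (hs : 2 ≤ s)
    (a : Fin m → ℝ) :
    ((2 : ℝ) ^ m)⁻¹ * ∑ ε, |signSum a ε| ^ s ≤
      (s ^ (s / 2) * (m : ℝ) ^ (s / 2 - 1)) * ∑ i, |a i| ^ s := by
  have hm0 : (0 : ℝ) < m := by exact_mod_cast hm
  have hk := Nat.le_ceil (s / 2)
  have hk' := Nat.ceil_lt_add_one (show 0 ≤ s / 2 by linarith)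
  refine (mean_abs_signSum_rpow_le a (k := ⌈s / 2⌉₊) (by linarith) (by linarith)).trans ?_
  have h0 : 0 ≤ ∑ i, a i ^ 2 := Finset.sum_nonneg fun _ _ => sq_nonneg _
  have h := Real.rpow_sum_le_const_mul_sum_rpow_of_nonneg (s := Finset.univ)
    (f := fun i => a i ^ 2) (p := s / 2) (by linarith) (fun _ _ => sq_nonneg _)
  have e : ∀ i, (a i ^ 2) ^ (s / 2) = |a i| ^ s := fun i => by
    rw [← sq_abs, ← Real.rpow_natCast, ← Real.rpow_mul (abs_nonneg _)]
    congr 1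
    push_cast
    ring
  simp only [e, Finset.card_univ, Fintype.card_fin] at h
  rw [Real.mul_rpow (by positivity) h0, mul_assoc]
  gcongr
  linarith

/-- Khintchine's inequality for exponents at most two, with the quadratic mean replaced by the
`l_s` norm of the coefficients. -/
lemma mean_abs_signSum_rpow_le_of_le_two {m : ℕ} {s : ℝ} (hs : 0 < s) (hs2 : s ≤ 2)
    (a : Fin m → ℝ) :
    ((2 : ℝ) ^ m)⁻¹ * ∑ ε, |signSum a ε| ^ s ≤ 1 * ∑ i, |a i| ^ s := by
  refine (mean_abs_signSum_rpow_le a (k := 1) hs (by simpa using hs2)).trans ?_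
  have h := vecLpNorm_anti (r := ENNReal.ofReal s) (s := ENNReal.ofReal 2) (by simpa using hs)
    (ENNReal.ofReal_le_ofReal hs2) a
  have h' := Real.rpow_le_rpow (vecLpNorm_nonneg _ _) h hs.le
  rw [vecLpNorm_rpow hs, vecLpNorm_ofReal zero_le_two, ← Real.rpow_mul (by positivity)] at h'
  rw [one_mul]
  refine le_of_eq_of_le ?_ h'
  simp only [Nat.cast_one, one_mul, Real.rpow_ofNat, sq_abs]
  congr 1
  ring

/-- A scalar moment bound for signed sums yields a bound for signed sums of vectors in `l_s`. -/
lemma mean_vecLpNorm_signSum_le {κ : Type*} [Fintype κ] {m : ℕ} (hm : 1 ≤ m) {s c V : ℝ}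
    (hs : 1 ≤ s) (hc : 0 ≤ c)
    (hK : ∀ a : Fin m → ℝ, ((2 : ℝ) ^ m)⁻¹ * ∑ ε, |signSum a ε| ^ s ≤ c * ∑ i, |a i| ^ s)
    (v : Fin m → κ → ℝ) (hV : ∀ i, vecLpNorm (ENNReal.ofReal s) (v i) ≤ V) :
    ((2 : ℝ) ^ m)⁻¹ *
        ∑ ε, vecLpNorm (ENNReal.ofReal s) (fun j => signSum (fun i => v i j) ε) ≤
      (c * m) ^ (1 / s) * V := by
  have hs0 : 0 < s := by linarith
  have hV0 : 0 ≤ V := (vecLpNorm_nonneg _ _).trans (hV ⟨0, hm⟩)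
  refine (mean_rpow_le hs _ fun ε => vecLpNorm_nonneg _ _).trans ?_
  simp only [vecLpNorm_rpow hs0]
  rw [one_div, Real.rpow_inv_le_iff_of_pos (by positivity) (by positivity) hs0,
    Real.mul_rpow (by positivity) hV0, Real.rpow_inv_rpow (by positivity) hs0.ne',
    Finset.sum_comm, Finset.mul_sum]
  calc ∑ j, ((2 : ℝ) ^ m)⁻¹ * ∑ ε, |signSum (fun i => v i j) ε| ^ s
      ≤ ∑ j, c * ∑ i, |v i j| ^ s := Finset.sum_le_sum fun j _ => hK _
    _ = c * ∑ i, vecLpNorm (ENNReal.ofReal s) (v i) ^ s := by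
        rw [← Finset.mul_sum, Finset.sum_comm]
        simp only [vecLpNorm_rpow hs0]
    _ ≤ c * ∑ _i : Fin m, V ^ s := by
        gcongr with i
        · exact vecLpNorm_nonneg _ _
        · exact hV i
    _ = c * m * V ^ s := by simp [mul_assoc]

lemma mean_vecLpNorm_signSum_le_of_two_le {κ : Type*} [Fintype κ] {m : ℕ} (hm : 1 ≤ m) {s V : ℝ}
    (hs : 2 ≤ s) (v : Fin m → κ → ℝ) (hV : ∀ i, vecLpNorm (ENNReal.ofReal s) (v i) ≤ V) :
    ((2 : ℝ) ^ m)⁻¹ *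
        ∑ ε, vecLpNorm (ENNReal.ofReal s) (fun j => signSum (fun i => v i j) ε) ≤
      √s * √m * V := by
  have hm0 : (0 : ℝ) < m := by exact_mod_cast hm
  have hs0 : 0 < s := by linarith
  refine (mean_vecLpNorm_signSum_le hm (by linarith) (by positivity)
    (mean_abs_signSum_rpow_le_of_two_le hm hs) v hV).trans_eq ?_
  congr 1
  have e : s ^ (s / 2) * (m : ℝ) ^ (s / 2 - 1) * m = (s * m) ^ (s / 2) := by
    rw [Real.rpow_sub_one hm0.ne', Real.mul_rpow hs0.le hm0.le]
    field_simp
  rw [e, ← Real.rpow_mul (by positivity), ← Real.sqrt_mul hs0.le, Real.sqrt_eq_rpow]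
  congr 1
  field_simp

lemma mean_vecLpNorm_hconj_le_of_le_two {n₀ m : ℕ} (hn₀ : 1 ≤ n₀) (hm : 1 ≤ m) {p V : ℝ}
    (hp : 1 ≤ p) (hp2 : p ≤ 2) (v : Fin m → Fin (4 ^ n₀ - 1) → ℝ)
    (hV : ∀ i, vecLpNorm (hconj p) (v i) ≤ V) :
    ((2 : ℝ) ^ m)⁻¹ * ∑ ε, vecLpNorm (hconj p) (fun j => signSum (fun i => v i j) ε) ≤
      √(minConj p n₀) * √m * V := by
  have hV0 : 0 ≤ V := (vecLpNorm_nonneg _ _).trans (hV ⟨0, hm⟩)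
  have hn : (1 : ℝ) ≤ n₀ := by exact_mod_cast hn₀
  have hlarge (h : ENNReal.ofReal (2 * n₀) ≤ hconj p) :
      ((2 : ℝ) ^ m)⁻¹ * ∑ ε, vecLpNorm (hconj p) (fun j => signSum (fun i => v i j) ε) ≤
        √(8 * n₀) * √m * V := by
    have hpos : 0 < ENNReal.ofReal (2 * n₀) := by rw [ENNReal.ofReal_pos]; linarith
    have h4 : 4 ≤ 4 ^ n₀ := by simpa using Nat.pow_le_pow_right (show 0 < 4 by norm_num) hn₀
    have : Nonempty (Fin (4 ^ n₀ - 1)) := ⟨⟨0, by omega⟩⟩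
    have hN1 : (1 : ℝ) ≤ Fintype.card (Fin (4 ^ n₀ - 1)) := by
      exact_mod_cast Fintype.card_pos
    have hN : (Fintype.card (Fin (4 ^ n₀ - 1)) : ℝ) ≤ 4 ^ n₀ := by
      rw [Fintype.card_fin]
      exact_mod_cast Nat.sub_le _ _
    have hV' : ∀ i, vecLpNorm (ENNReal.ofReal (2 * n₀)) (v i) ≤ 2 * V := fun i => by
      refine (vecLpNorm_le_card_rpow_mul hpos h ENNReal.ofReal_ne_top (v i)).trans ?_
      have hexp : (Fintype.card (Fin (4 ^ n₀ - 1)) : ℝ) ^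
          ((ENNReal.ofReal (2 * n₀))⁻¹.toReal - (hconj p)⁻¹.toReal) ≤ 2 := by
        calc _ ≤ (Fintype.card (Fin (4 ^ n₀ - 1)) : ℝ) ^ (ENNReal.ofReal (2 * n₀))⁻¹.toReal := by
              exact Real.rpow_le_rpow_of_exponent_le hN1 (sub_le_self _ ENNReal.toReal_nonneg)
          _ ≤ ((4 : ℝ) ^ n₀) ^ (ENNReal.ofReal (2 * n₀))⁻¹.toReal := by
              gcongr
          _ = 2 := by
              rw [ENNReal.toReal_inv, ENNReal.toReal_ofReal (by positivity),
                show (4 : ℝ) ^ n₀ = 2 ^ (2 * (n₀ : ℝ)) by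
                  rw [Real.rpow_mul zero_le_two, Real.rpow_natCast]; norm_num,
                Real.rpow_rpow_inv zero_le_two (by positivity)]
      have := hV i
      have := vecLpNorm_nonneg (hconj p) (v i)
      gcongr
    calc _ ≤ ((2 : ℝ) ^ m)⁻¹ * ∑ ε, vecLpNorm (ENNReal.ofReal (2 * n₀))
          (fun j => signSum (fun i => v i j) ε) := by
          gcongr
          exact vecLpNorm_anti hpos h _
      _ ≤ √(2 * n₀) * √m * (2 * V) :=
          mean_vecLpNorm_signSum_le_of_two_le hm (by linarith) v hV'
      _ = √(8 * n₀) * √m * V := by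
          rw [show (8 : ℝ) * n₀ = 2 ^ 2 * (2 * n₀) by ring, Real.sqrt_mul (by positivity) (2 * (n₀ : ℝ)),
            Real.sqrt_sq zero_le_two]
          ring
  unfold minConj
  split_ifs with h1
  · exact hlarge (by simp [hconj, h1])
  · have hp1 : 0 < p - 1 := sub_pos.2 (lt_of_le_of_ne hp (Ne.symm h1))
    rcases le_total (p / (p - 1)) (8 * n₀) with h | h
    · rw [min_eq_left h]
      rw [hconj, if_neg h1] at hV ⊢
      refine mean_vecLpNorm_signSum_le_of_two_le hm ?_ v hV
      rw [le_div_iff₀ hp1]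
      linarith
    · rw [min_eq_right h]
      refine hlarge ?_
      rw [hconj, if_neg h1]
      exact ENNReal.ofReal_le_ofReal (by linarith)

lemma mean_vecLpNorm_hconj_le_of_two_lt {κ : Type*} [Fintype κ] {m : ℕ} (hm : 1 ≤ m) {p V : ℝ}
    (hp2 : 2 < p) (v : Fin m → κ → ℝ) (hV : ∀ i, vecLpNorm (hconj p) (v i) ≤ V) :
    ((2 : ℝ) ^ m)⁻¹ * ∑ ε, vecLpNorm (hconj p) (fun j => signSum (fun i => v i j) ε) ≤
      √(p / (p - 1)) * (m : ℝ) ^ (1 - 1 / p) * V := by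
  have hV0 : 0 ≤ V := (vecLpNorm_nonneg _ _).trans (hV ⟨0, hm⟩)
  have hp1 : 0 < p - 1 := by linarith
  have hs1 : 1 ≤ p / (p - 1) := by rw [le_div_iff₀ hp1]; linarith
  have hs2 : p / (p - 1) ≤ 2 := by rw [div_le_iff₀ hp1]; linarith
  rw [hconj, if_neg (by linarith)] at hV ⊢
  refine (mean_vecLpNorm_signSum_le hm hs1 zero_le_one
    (mean_abs_signSum_rpow_le_of_le_two (by linarith) hs2) v hV).trans ?_
  have e : 1 / (p / (p - 1)) = 1 - 1 / p := by field_simp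
  rw [one_mul, e, mul_assoc]
  exact le_mul_of_one_le_left (by positivity) (Real.one_le_sqrt.2 hs1)

lemma abs_dotProduct_mulVec_le {ι κ : Type*} [Fintype ι] [Fintype κ] [Nonempty ι]
    {p : ℝ} (hp : 1 ≤ p) {q : ℝ≥0∞} (hq : 0 < q) (α : ι → ℝ) (M : Matrix ι κ ℝ) (w : κ → ℝ) :
    |α ⬝ᵥ M *ᵥ w| ≤ vecLpNorm (ENNReal.ofReal p) α *
      ((Fintype.card ι : ℝ) ^ max (1 - 1 / p) q⁻¹.toReal * groupNorm (ENNReal.ofReal p) q M) *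
        vecLpNorm (hconj p) w := by
  set x : ι → ℝ := fun i => vecLpNorm (ENNReal.ofReal p) (M i)
  have hrows := vecLpNorm_rows_le_groupNorm (p := ENNReal.ofReal p)
    (zero_lt_one.trans_le (one_le_hconj hp)) hq M
  rw [toReal_inv_hconj hp] at hrows
  have habs : vecLpNorm (ENNReal.ofReal p) (fun i => |α i|) = vecLpNorm (ENNReal.ofReal p) α := by
    simp [vecLpNorm]
  calc |α ⬝ᵥ M *ᵥ w| ≤ ∑ i, |α i| * (x i * vecLpNorm (hconj p) w) := by
        refine (Finset.abs_sum_le_sum_abs _ _).trans (Finset.sum_le_sum fun i _ => ?_)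
        rw [abs_mul]
        gcongr
        exact abs_dotProduct_le hp (M i) w
    _ = ((fun i => |α i|) ⬝ᵥ x) * vecLpNorm (hconj p) w := by
        simp only [dotProduct, Finset.sum_mul, mul_assoc]
    _ ≤ vecLpNorm (ENNReal.ofReal p) α * vecLpNorm (hconj p) x * vecLpNorm (hconj p) w := by
        have := (le_abs_self _).trans (abs_dotProduct_le hp (fun i => |α i|) x)
        rw [habs] at this
        exact mul_le_mul_of_nonneg_right this (vecLpNorm_nonneg _ _)
    _ ≤ _ := mul_le_mul_of_nonneg_right
        (mul_le_mul_of_nonneg_left hrows (vecLpNorm_nonneg _ _)) (vecLpNorm_nonneg _ _)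

lemma sum_sign_mul_dotProduct_mulVec {ι κ : Type*} [Fintype ι] [Fintype κ] {m : ℕ} (α : ι → ℝ)
    (M : Matrix ι κ ℝ) (v : Fin m → κ → ℝ) (ε : Fin m → Bool) :
    ∑ i, (if ε i then (1 : ℝ) else -1) * (α ⬝ᵥ M *ᵥ v i) =
      α ⬝ᵥ M *ᵥ (fun j => signSum (fun i => v i j) ε) := by
  have : (fun j => signSum (fun i => v i j) ε) =
      ∑ i, (if ε i then (1 : ℝ) else -1) • v i := by
    ext j
    rw [Finset.sum_apply]
    rfl
  simp only [this, Matrix.mulVec_sum, dotProduct_sum, Matrix.mulVec_smul, dotProduct_smul,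
    smul_eq_mul]

/-- Theorem 2: Rademacher complexity of unital quantum circuits (traceless observable),
via the `(p,q)` group norm of the modified representation matrix (the identity row and
column deleted), bounded by `μ`. Here `N₁ = 4^{n₁} - 1` and `N₀ = 4^{n₀} - 1`. -/
theorem statement1
    (n₀ n₁ m : ℕ) (hn₀ : 1 ≤ n₀) (hn₁ : 1 ≤ n₁) (hm : 1 ≤ m)
    (p : ℝ) (q : ℝ≥0∞) (hp : 1 ≤ p) (hq : 0 < q)
    (μ : ℝ) (hμ : 0 < μ)
    (α : Fin (4 ^ n₁ - 1) → ℝ) (v : Fin m → Fin (4 ^ n₀ - 1) → ℝ)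
    (𝒞 : Set (Matrix (Fin (4 ^ n₁ - 1)) (Fin (4 ^ n₀ - 1)) ℝ))
    (hne : 𝒞.Nonempty)
    (hbdd : ∀ M ∈ 𝒞, groupNorm (ENNReal.ofReal p) q M ≤ μ) :
    let R : ℝ := ((2 : ℝ) ^ m)⁻¹ * ∑ ε : Fin m → Bool, (m : ℝ)⁻¹ *
      (⨆ M : 𝒞, |∑ i, (if ε i then (1 : ℝ) else -1) * (α ⬝ᵥ (M.1.mulVec (v i)))|)
    (p ≤ 2 →
      R ≤ μ * ((4 ^ n₁ - 1 : ℕ) : ℝ) ^ max (1 - 1 / p) q⁻¹.toReal *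
        (Real.sqrt (minConj p n₀) / Real.sqrt (m : ℝ)) *
        vecLpNorm (ENNReal.ofReal p) α * (⨆ i, vecLpNorm (hconj p) (v i))) ∧
    (2 < p →
      R ≤ μ * ((4 ^ n₁ - 1 : ℕ) : ℝ) ^ max (1 - 1 / p) q⁻¹.toReal *
        (Real.sqrt (p / (p - 1)) / (m : ℝ) ^ (1 / p)) *
        vecLpNorm (ENNReal.ofReal p) α * (⨆ i, vecLpNorm (hconj p) (v i))) := by
  intro R
  have h4 : 4 ≤ 4 ^ n₁ := by simpa using Nat.pow_le_pow_right (show 0 < 4 by norm_num) hn₁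
  have : Nonempty (Fin (4 ^ n₁ - 1)) := ⟨⟨0, by omega⟩⟩
  have : Nonempty 𝒞 := hne.to_subtype
  have hm0 : (0 : ℝ) < m := by exact_mod_cast hm
  have hV : ∀ i, vecLpNorm (hconj p) (v i) ≤ ⨆ i, vecLpNorm (hconj p) (v i) := fun i =>
    le_ciSup (f := fun i => vecLpNorm (hconj p) (v i)) (Set.finite_range _).bddAbove i
  set V := ⨆ i, vecLpNorm (hconj p) (v i)
  set A := vecLpNorm (ENNReal.ofReal p) α
  have hA : 0 ≤ A := vecLpNorm_nonneg _ _
  set N : ℝ := ((4 ^ n₁ - 1 : ℕ) : ℝ) ^ max (1 - 1 / p) q⁻¹.toReal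
  have hN : 0 ≤ N := by positivity
  have hR : R ≤ A * (N * μ) * (m : ℝ)⁻¹ * (((2 : ℝ) ^ m)⁻¹ *
      ∑ ε, vecLpNorm (hconj p) (fun j => signSum (fun i => v i j) ε)) := by
    calc R ≤ ((2 : ℝ) ^ m)⁻¹ * ∑ ε : Fin m → Bool, (m : ℝ)⁻¹ * (A * (N * μ) *
          vecLpNorm (hconj p) (fun j => signSum (fun i => v i j) ε)) := by
          refine mul_le_mul_of_nonneg_left (Finset.sum_le_sum fun ε _ =>
            mul_le_mul_of_nonneg_left (ciSup_le fun M => ?_) (by positivity)) (by positivity)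
          rw [sum_sign_mul_dotProduct_mulVec]
          refine (abs_dotProduct_mulVec_le hp hq α M.1 _).trans ?_
          rw [Fintype.card_fin]
          have := hbdd M.1 M.2
          have := vecLpNorm_nonneg (hconj p) (fun j => signSum (fun i => v i j) ε)
          gcongr
      _ = _ := by
          rw [← Finset.mul_sum, ← Finset.mul_sum]
          ring
  refine ⟨fun h => ?_, fun h => ?_⟩
  · refine (hR.trans (mul_le_mul_of_nonneg_left
      (mean_vecLpNorm_hconj_le_of_le_two hn₀ hm hp h v hV) (by positivity))).trans_eq ?_
    have hsq : (m : ℝ)⁻¹ * √m = (√m)⁻¹ := by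
      rw [inv_mul_eq_div, Real.sqrt_div_self', one_div]
    rw [div_eq_mul_inv √_, ← hsq]
    ring
  · refine (hR.trans (mul_le_mul_of_nonneg_left
      (mean_vecLpNorm_hconj_le_of_two_lt hm h v hV) (by positivity))).trans_eq ?_
    have hpow : (m : ℝ)⁻¹ * (m : ℝ) ^ (1 - 1 / p) = ((m : ℝ) ^ (1 / p))⁻¹ := by
      rw [Real.rpow_sub hm0, Real.rpow_one]
      field_simp
    rw [div_eq_mul_inv √_, ← hpow]
    ring
end

section
/- Let C⃗_l = (M_l, …, M_1) and C⃗'_l = (M'_l, …, M'_1) be two tuples of real matrices of the same length l, with M_k of size N_k×N_{k−1} and M'_k of size N'_k×N'_{k−1}. Define their tensor product C⃗_l ⊗ C⃗'_l = (M_l ⊗ M'_l, …, M_1 ⊗ M'_1), where ⊗ is the Kronecker product. Then for every 0 < p < ∞ and 0 < q ≤ ∞, the (p,q) path norm is multiplicative: γ_{p,q}(C⃗_l ⊗ C⃗'_l) = γ_{p,q}(C⃗_l) · γ_{p,q}(C⃗'_l); indeed, for all row indices z of M_l and z' of M'_l, γ^{(z,z')}_p(C⃗_l ⊗ C⃗'_l)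 = γ^{(z)}_p(C⃗_l) · γ^{(z')}_p(C⃗'_l). -/
open scoped ENNReal BigOperators Kronecker
open Matrix

/-- `pathP ι p M l z` is the sum over all paths `v₀ → v₁ → ⋯ → v_l = z` of the
`p`-th powers `|[M_l]_{z,v_{l-1}} ⋯ [M_1]_{v_1,v_0}|^p`; so the path quantity
`γ^{(z)}_p` of the depth-`l` tuple `(M_l, …, M_1)` is `(pathP ι p M l z) ^ (1/p)`. -/
noncomputable def pathP (ι : ℕ → Type*) [∀ k, Fintype (ι k)] (p : ℝ)
    (M : ∀ k, Matrix (ι (k + 1)) (ι k) ℝ) : ∀ l, ι l → ℝ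
  | 0, _ => 1
  | l + 1, z => ∑ y, |M l z y| ^ p * pathP ι p M l y

/-- The `(p,q)` path norm `γ_{p,q}` of the depth-`l` tuple `(M_l, …, M_1)`:
`γ_{p,q} = ((1/N_l) ∑_z (γ^{(z)}_p)^q)^{1/q}`, with `γ_{p,∞} = max_z γ^{(z)}_p`. -/
noncomputable def pathNorm (ι : ℕ → Type*) [∀ k, Fintype (ι k)] (p : ℝ) (q : ℝ≥0∞)
    (M : ∀ k, Matrix (ι (k + 1)) (ι k) ℝ) (l : ℕ) : ℝ :=
  if q = ∞ then ⨆ z : ι l, pathP ι p M l z ^ (1 / p)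
  else ((Fintype.card (ι l) : ℝ)⁻¹ * ∑ z : ι l, (pathP ι p M l z ^ (1 / p)) ^ q.toReal) ^
    (1 / q.toReal)

/-- The path sums are nonnegative. -/
theorem pathP_nonneg (ι : ℕ → Type*) [∀ k, Fintype (ι k)] (p : ℝ)
    (M : ∀ k, Matrix (ι (k + 1)) (ι k) ℝ) : ∀ (l : ℕ) (z : ι l), 0 ≤ pathP ι p M l z
  | 0, _ => zero_le_one
  | l + 1, _ => Finset.sum_nonneg fun y _ =>
      mul_nonneg (Real.rpow_nonneg (abs_nonneg _) p) (pathP_nonneg ι p M l y)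

/-- The path sums are multiplicative under the layerwise Kronecker product. -/
theorem pathP_kronecker (ι κ : ℕ → Type*) [∀ k, Fintype (ι k)] [∀ k, Fintype (κ k)] (p : ℝ)
    (M : ∀ k, Matrix (ι (k + 1)) (ι k) ℝ) (M' : ∀ k, Matrix (κ (k + 1)) (κ k) ℝ)
    (l : ℕ) (z : ι l) (z' : κ l) :
    pathP (fun k => ι k × κ k) p (fun k => M k ⊗ₖ M' k) l (z, z') =
      pathP ι p M l z * pathP κ p M' l z' := by
  induction l with
  | zero => simp [pathP]
  | succ l ih =>
    simp only [pathP]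
    rw [Fintype.sum_mul_sum, Fintype.sum_prod_type]
    refine Finset.sum_congr rfl fun y _ => Finset.sum_congr rfl fun y' _ => ?_
    rw [ih, kroneckerMap_apply, abs_mul, Real.mul_rpow (abs_nonneg _) (abs_nonneg _)]
    ring

/-- The supremum of a product of nonnegative functions of independent variables is the product of
the suprema. -/
theorem Real.iSup_prod_mul {α β : Type*} [Finite α] [Finite β] {f : α → ℝ} {g : β → ℝ}
    (hf : ∀ a, 0 ≤ f a) (hg : ∀ b, 0 ≤ g b) :
    ⨆ x : α × β, f x.1 * g x.2 = (⨆ a, f a) * ⨆ b, g b := by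
  have hfg : ∀ x : α × β, 0 ≤ f x.1 * g x.2 := fun x => mul_nonneg (hf _) (hg _)
  apply le_antisymm
  · refine Real.iSup_le (fun x => ?_) (mul_nonneg (Real.iSup_nonneg hf) (Real.iSup_nonneg hg))
    exact mul_le_mul (le_ciSup (Set.finite_range f).bddAbove x.1)
      (le_ciSup (Set.finite_range g).bddAbove x.2) (hg _) (Real.iSup_nonneg hf)
  · rw [Real.iSup_mul_of_nonneg (Real.iSup_nonneg hg)]
    refine Real.iSup_le (fun a => ?_) (Real.iSup_nonneg hfg)
    rw [Real.mul_iSup_of_nonneg (hf a)]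
    exact Real.iSup_le (fun b => le_ciSup (f := fun x : α × β => f x.1 * g x.2)
      (Set.finite_range _).bddAbove (a, b)) (Real.iSup_nonneg hfg)

/-- Multiplicativity of the path quantities and the `(p,q)` path norm under the layerwise
Kronecker (tensor) product of two depth-`l` tuples of matrices. -/
theorem statement19 (l : ℕ) (N N' : ℕ → ℕ)
    (M : ∀ k, Matrix (Fin (N (k + 1))) (Fin (N k)) ℝ)
    (M' : ∀ k, Matrix (Fin (N' (k + 1))) (Fin (N' k)) ℝ)
    (p : ℝ) (hp : 0 < p) :
    (∀ (z : Fin (N l)) (z' : Fin (N' l)),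
      pathP (fun k => Fin (N k) × Fin (N' k)) p (fun k => M k ⊗ₖ M' k) l (z, z') ^ (1 / p) =
        pathP (fun k => Fin (N k)) p M l z ^ (1 / p) *
          pathP (fun k => Fin (N' k)) p M' l z' ^ (1 / p)) ∧
    ∀ q : ℝ≥0∞, 0 < q →
      pathNorm (fun k => Fin (N k) × Fin (N' k)) p q (fun k => M k ⊗ₖ M' k) l =
        pathNorm (fun k => Fin (N k)) p q M l * pathNorm (fun k => Fin (N' k)) p q M' l := by
  have hγ : ∀ z z',
      pathP (fun k => Fin (N k) × Fin (N' k)) p (fun k => M k ⊗ₖ M' k) l (z, z') ^ (1 / p) =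
        pathP (fun k => Fin (N k)) p M l z ^ (1 / p) *
          pathP (fun k => Fin (N' k)) p M' l z' ^ (1 / p) := fun z z' => by
    rw [pathP_kronecker (fun k => Fin (N k)) (fun k => Fin (N' k)),
      Real.mul_rpow (pathP_nonneg _ _ _ _ _) (pathP_nonneg _ _ _ _ _)]
  have h₁ : ∀ z, 0 ≤ pathP (fun k => Fin (N k)) p M l z ^ (1 / p) :=
    fun z => Real.rpow_nonneg (pathP_nonneg _ _ _ _ _) _
  have h₂ : ∀ z, 0 ≤ pathP (fun k => Fin (N' k)) p M' l z ^ (1 / p) :=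
    fun z => Real.rpow_nonneg (pathP_nonneg _ _ _ _ _) _
  refine ⟨hγ, fun q _ => ?_⟩
  unfold pathNorm
  split_ifs
  · rw [← Real.iSup_prod_mul h₁ h₂]
    exact iSup_congr fun x => hγ x.1 x.2
  · have s₁ := Finset.sum_nonneg fun z (_ : z ∈ Finset.univ) => Real.rpow_nonneg (h₁ z) q.toReal
    have s₂ := Finset.sum_nonneg fun z (_ : z ∈ Finset.univ) => Real.rpow_nonneg (h₂ z) q.toReal
    rw [← Real.mul_rpow (mul_nonneg (by positivity) s₁) (mul_nonneg (by positivity) s₂),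
      mul_mul_mul_comm, Fintype.sum_mul_sum, Fintype.sum_prod_type, Fintype.card_prod,
      Nat.cast_mul, mul_inv]
    simp only [hγ, Real.mul_rpow (h₁ _) (h₂ _)]
end
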